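/- Let X be a finite set and let T be a total order on X (a reflexive, transitive, antisymmetric relation in which any two elements are comparable, viewed as a subset of X × X). Then T T = T (composition of correspondences), and for every permutation ρ of X with ρ ≠ id, the composition T Δ_ρ T is inessential. -/

import Mathlib

/-- Composition of correspondences: `RS = {(x,z) : ∃ y, (x,y) ∈ R ∧ (y,z) ∈ S}`. -/
def CorrRel.comp {X Y Z : Type*} (R : Set (X × Y)) (S : Set (Y × Z)) : Set (X × Z) :=
  {p | ∃ y, (p.1, y) ∈ R ∧ (y, p.2) ∈ S}

/-- A relation on a finite set `X` is inessential if it factorizes through a set of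
cardinality strictly smaller than `|X|`. -/
def CorrRel.Inessential {X : Type*} [Fintype X] (R : Set (X × X)) : Prop :=
  ∃ m : ℕ, m < Fintype.card X ∧
    ∃ (S : Set (X × Fin m)) (T : Set (Fin m × X)), R = CorrRel.comp S T

/-- A relation is essential if it is not inessential. -/
def CorrRel.Essential {X : Type*} [Fintype X] (R : Set (X × X)) : Prop :=
  ¬ CorrRel.Inessential R

/-- The diagonal `Δ = {(x,x) : x ∈ X}`. -/
def CorrRel.diag (X : Type*) : Set (X × X) := {p | p.1 = p.2}

/-- The permutation relation `Δ_σ = {(σ x, x) : x ∈ X}`. -/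
def CorrRel.deltaPerm {X : Type*} (σ : Equiv.Perm X) : Set (X × X) :=
  {p | p.1 = σ p.2}

/-- A relation factorizing through a finite type smaller than `X` is inessential. -/
theorem CorrRel.Inessential.of_comp {X Y : Type*} [Fintype X] [Fintype Y]
    (hcard : Fintype.card Y < Fintype.card X) (S : Set (X × Y)) (T : Set (Y × X)) :
    CorrRel.Inessential (CorrRel.comp S T) := by
  let e := Fintype.equivFin Y
  refine ⟨Fintype.card Y, hcard, {p | (p.1, e.symm p.2) ∈ S}, {p | (e.symm p.1, p.2) ∈ T}, ?_⟩
  ext p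
  exact (e.symm.exists_congr_right (q := fun y => (p.1, y) ∈ S ∧ (y, p.2) ∈ T)).symm

/-- A nontrivial permutation of a finite linear order has an inversion. -/
theorem Equiv.Perm.exists_lt_and_apply_le {X : Type*} [LinearOrder X] [Finite X]
    {ρ : Equiv.Perm X} (hρ : ρ ≠ 1) : ∃ a b, a < b ∧ ρ b ≤ ρ a := by
  by_contra! h
  have hmono : StrictMono ρ := fun a b hab => h a b hab
  exact hρ (Equiv.ext fun x => le_antisymm hmono.apply_le hmono.le_apply)

/-- For a total order T: T composed with T equals T, and T Δ_ρ T is inessential for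
every nontrivial permutation ρ. -/
theorem total_order_idempotent_orthogonal {X : Type*} [Fintype X] (T : Set (X × X))
    (hrefl : ∀ x : X, (x, x) ∈ T)
    (htrans : ∀ x y z : X, (x, y) ∈ T → (y, z) ∈ T → (x, z) ∈ T)
    (hanti : ∀ x y : X, (x, y) ∈ T → (y, x) ∈ T → x = y)
    (htotal : ∀ x y : X, (x, y) ∈ T ∨ (y, x) ∈ T) :
    CorrRel.comp T T = T ∧
      ∀ ρ : Equiv.Perm X, ρ ≠ 1 →
        CorrRel.Inessential (CorrRel.comp (CorrRel.comp T (CorrRel.deltaPerm ρ)) T) := by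
  classical
  refine ⟨?_, fun ρ hρ => ?_⟩
  · ext ⟨x, z⟩
    exact ⟨fun ⟨y, hxy, hyz⟩ => htrans x y z hxy hyz, fun h => ⟨x, hrefl x, h⟩⟩
  let _ : LinearOrder X :=
    { le := fun x y => (x, y) ∈ T
      le_refl := hrefl
      le_trans := htrans
      le_antisymm := hanti
      le_total := htotal
      toDecidableLE := Classical.decRel _ }
  obtain ⟨a, b, hab, hρab⟩ := Equiv.Perm.exists_lt_and_apply_le hρ
  have hcard : Fintype.card {z : X // z ≠ b} < Fintype.card X :=
    Fintype.card_subtype_lt (x := b) (by simp)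
  convert CorrRel.Inessential.of_comp hcard {p | (p.1, ρ p.2) ∈ T} {p | (p.1.1, p.2) ∈ T} using 1
  ext ⟨x, y⟩
  constructor
  · rintro ⟨z, ⟨w, hxw, hw : w = ρ z⟩, hzy⟩
    subst hw
    by_cases hz : z = b
    · subst hz
      exact ⟨⟨a, hab.ne⟩, htrans _ _ _ hxw hρab, htrans _ _ _ hab.le hzy⟩
    · exact ⟨⟨z, hz⟩, hxw, hzy⟩
  · rintro ⟨z, hxz, hzy⟩
    exact ⟨z, ⟨ρ z, hxz, rfl⟩, hzy⟩
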